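/- Let d be a real number with 0 ≤ d < 1/2. Then the iterated integral ∫₀¹∫₀^{y₁}∫₀^{y₂}∫₀^{y₃} (y₁−y₃)^(−d)(y₂−y₃)^(−d)(y₁−y₄)^(−d)(y₂−y₄)^(−d) dy₄ dy₃ dy₂ dy₁ equals (1/(2(1−d)²))·(Γ(3−4d)/Γ(5−4d))·₃F₂(1, d, 2−2d; 2−d, 3−2d; 1). -/

import Mathlib

open Real

noncomputable def poch (a : ℝ) (k : ℕ) : ℝ := ∏ i ∈ Finset.range k, (a + i)

noncomputable def F21 (a b c x : ℝ) : ℝ :=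
  ∑' k : ℕ, poch a k * poch b k / (poch c k * (Nat.factorial k : ℝ)) * x ^ k

noncomputable def F32 (a b c e f : ℝ) : ℝ :=
  ∑' k : ℕ, poch a k * poch b k * poch c k / (poch e k * poch f k * (Nat.factorial k : ℝ))

noncomputable def F32x (a b c e f x : ℝ) : ℝ :=
  ∑' k : ℕ, poch a k * poch b k * poch c k / (poch e k * poch f k * (Nat.factorial k : ℝ)) * x ^ k

noncomputable def F43 (a b c g e f h : ℝ) : ℝ :=
  ∑' k : ℕ, poch a k * poch b k * poch c k * poch g k /
    (poch e k * poch f k * poch h k * (Nat.factorial k : ℝ))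


open MeasureTheory Set intervalIntegral

noncomputable def gg (d x : ℝ) : ℝ := x ^ (-d) * (1-x) ^ (2*d-2)
noncomputable def BB (d : ℝ) (k : ℕ) (t : ℝ) : ℝ := ∫ x in (0:ℝ)..t, x ^ k * gg d x
noncomputable def SS (d : ℝ) (k : ℕ) (t : ℝ) : ℝ := (1-t) ^ (1-2*d) * BB d k t
noncomputable def mm (d : ℝ) (k : ℕ) : ℝ := ∫ t in (0:ℝ)..1, t ^ (-d) * SS d k t

lemma gg_int (d : ℝ) (h1 : d < 1/2) (k : ℕ) {t : ℝ} (ht0 : 0 ≤ t) (ht : t < 1) :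
    IntervalIntegrable (fun x => x ^ k * gg d x) volume 0 t := by
  have h : IntervalIntegrable (fun x : ℝ => x ^ (-d)) volume 0 t := intervalIntegrable_rpow' (by linarith)
  have hc : ContinuousOn (fun x : ℝ => x ^ k * (1-x) ^ (2*d-2)) (uIcc 0 t) := by
    rw [uIcc_of_le ht0]
    apply ContinuousOn.mul (by fun_prop)
    apply ContinuousOn.rpow_const (by fun_prop)
    intro x hx; left; have := hx.2; linarith
  have := h.mul_continuousOn hc
  refine this.congr ?_
  intro x _; simp only [gg]; ring

lemma gg_nonneg (d : ℝ) {x : ℝ} (h0 : 0 ≤ x) (h1 : x ≤ 1) : 0 ≤ gg d x :=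
  mul_nonneg (rpow_nonneg h0 _) (rpow_nonneg (by linarith) _)

lemma gg_cont (d : ℝ) (k : ℕ) : ContinuousOn (fun x => x ^ k * gg d x) (Ioo 0 1) := by
  unfold gg
  refine ContinuousOn.mul (by fun_prop) (ContinuousOn.mul ?_ ?_)
  · exact ContinuousOn.rpow_const (by fun_prop) (fun x hx => Or.inl hx.1.ne')
  · exact ContinuousOn.rpow_const (by fun_prop) (fun x hx => Or.inl (by have := hx.2; linarith))

lemma BB_cont (d : ℝ) (h1 : d < 1/2) (k : ℕ) {t : ℝ} (ht0 : 0 ≤ t) (ht : t < 1) :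
    ContinuousOn (BB d k) (Icc 0 t) := by
  have := continuousOn_primitive_interval (μ := volume) (f := fun x => x ^ k * gg d x) (a := 0) (b := t)
    (by rw [← intervalIntegrable_iff']; exact gg_int d h1 k ht0 ht)
  rw [uIcc_of_le ht0] at this
  exact this

lemma BB_deriv (d : ℝ) (h1 : d < 1/2) (k : ℕ) {t : ℝ} (ht0 : 0 < t) (ht : t < 1) :
    HasDerivAt (BB d k) (t ^ k * gg d t) t := by
  have hm : Ioo (0:ℝ) 1 ∈ nhds t := Ioo_mem_nhds ht0 ht
  exact integral_hasDerivAt_right (gg_int d h1 k ht0.le ht)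
    ((gg_cont d k).stronglyMeasurableAtFilter isOpen_Ioo t ⟨ht0, ht⟩)
    ((gg_cont d k).continuousAt hm)

/-- recursion -/
lemma BB_rec (d : ℝ) (h1 : d < 1/2) (k : ℕ) {t : ℝ} (ht0 : 0 ≤ t) (ht : t < 1) :
    t ^ ((k:ℝ)+1-d) * (1-t) ^ (2*d-1) = (k+1-d) * BB d k t - (k+d) * BB d (k+1) t := by
  have hk : (0:ℝ) ≤ k := Nat.cast_nonneg k
  have key := integral_eq_sub_of_hasDerivAt_of_le (a := 0) (b := t) ht0
    (f := fun x : ℝ => x ^ ((k:ℝ)+1-d) * (1-x) ^ (2*d-1))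
    (f' := fun x : ℝ => (k+1-d) * (x ^ k * gg d x) - (k+d) * (x ^ (k+1) * gg d x))
    (by
      apply ContinuousOn.mul
      · exact ContinuousOn.rpow_const (by fun_prop) (fun x hx => Or.inr (by linarith))
      · exact ContinuousOn.rpow_const (by fun_prop) (fun x hx => Or.inl (by have := hx.2; linarith)))
    (by
      intro x hx
      have hx0 : 0 < x := hx.1
      have hx1 : 0 < 1 - x := by have := hx.2; linarith
      have e1 : HasDerivAt (fun x : ℝ => x ^ ((k:ℝ)+1-d)) (((k:ℝ)+1-d) * x ^ ((k:ℝ)+1-d-1)) x :=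
        Real.hasDerivAt_rpow_const (Or.inl hx0.ne')
      have e2 : HasDerivAt (fun x : ℝ => (1-x) ^ (2*d-1)) (-1 * (2*d-1) * (1-x)^(2*d-1-1)) x :=
        ((hasDerivAt_id x).const_sub 1).rpow_const (Or.inl hx1.ne')
      refine (e1.mul e2).congr_deriv ?_
      have a1 : x ^ ((k:ℝ)+1-d-1) = x ^ k * x ^ (-d) := by
        rw [← rpow_natCast, ← rpow_add hx0]; congr 1; ring
      have a2 : x ^ ((k:ℝ)+1-d) = x ^ k * x ^ (-d) * x := by
        rw [← a1, ← rpow_add_one hx0.ne']; congr 1; ring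
      have a3 : (1-x) ^ (2*d-1-1) = (1-x) ^ (2*d-2) := by congr 1; ring
      have a4 : (1-x) ^ (2*d-1) = (1-x) ^ (2*d-2) * (1-x) := by
        rw [← rpow_add_one hx1.ne']; congr 1; ring
      rw [a1, a2, a3, a4, gg]; ring)
    (((gg_int d h1 k ht0 ht).const_mul _).sub ((gg_int d h1 (k+1) ht0 ht).const_mul _))
  rw [intervalIntegral.integral_sub ((gg_int d h1 k ht0 ht).const_mul _) ((gg_int d h1 (k+1) ht0 ht).const_mul _),
    intervalIntegral.integral_const_mul, intervalIntegral.integral_const_mul] at key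
  simp only [BB]
  rw [key, zero_rpow (by linarith)]; ring

lemma BB_nonneg (d : ℝ) (k : ℕ) {t : ℝ} (ht0 : 0 ≤ t) (ht : t ≤ 1) : 0 ≤ BB d k t :=
  intervalIntegral.integral_nonneg ht0
    (fun x hx => mul_nonneg (pow_nonneg hx.1 _) (gg_nonneg d hx.1 (hx.2.trans ht)))

lemma BB_le (d : ℝ) (h1 : d < 1/2) (k : ℕ) {t : ℝ} (ht0 : 0 ≤ t) (ht : t < 1) :
    BB d k t ≤ t ^ k * BB d 0 t := by
  unfold BB
  rw [← intervalIntegral.integral_const_mul]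
  apply intervalIntegral.integral_mono_on ht0 (gg_int d h1 k ht0 ht) ((gg_int d h1 0 ht0 ht).const_mul _)
  intro x hx
  have := gg_nonneg d hx.1 (hx.2.trans ht.le)
  have := pow_le_pow_left₀ hx.1 hx.2 k
  simp only [pow_zero, one_mul]
  gcongr

lemma SS_nonneg (d : ℝ) (k : ℕ) {t : ℝ} (ht0 : 0 ≤ t) (ht : t ≤ 1) : 0 ≤ SS d k t :=
  mul_nonneg (rpow_nonneg (by linarith) _) (BB_nonneg d k ht0 ht)

lemma SS_rec (d : ℝ) (h1 : d < 1/2) (k : ℕ) {t : ℝ} (ht0 : 0 ≤ t) (ht : t < 1) :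
    t ^ ((k:ℝ)+1-d) = (k+1-d) * SS d k t - (k+d) * SS d (k+1) t := by
  have h := BB_rec d h1 k ht0 ht
  have hx1 : 0 < 1 - t := by linarith
  have e : (1-t) ^ (2*d-1) * (1-t) ^ (1-2*d) = 1 := by
    rw [← rpow_add hx1]; simp
  unfold SS
  calc t ^ ((k:ℝ)+1-d) = (t ^ ((k:ℝ)+1-d) * (1-t) ^ (2*d-1)) * (1-t) ^ (1-2*d) := by
        rw [mul_assoc, e, mul_one]
    _ = _ := by rw [h]; ring

lemma SS_le (d : ℝ) (h0 : 0 ≤ d) (h1 : d < 1/2) (k : ℕ) {t : ℝ} (ht0 : 0 ≤ t) (ht : t ≤ 1) :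
    SS d k t ≤ t ^ k * (1 / (1-2*d)) := by
  have hd : 0 < 1 - 2*d := by linarith
  rcases ht.eq_or_lt with rfl | ht
  · simp only [SS, sub_self, zero_rpow hd.ne', zero_mul]; positivity
  have hle : ∀ k, SS d k t ≤ t ^ k * SS d 0 t := by
    intro k
    unfold SS
    have := BB_le d h1 k ht0 ht
    have h2 : 0 ≤ (1-t) ^ (1-2*d) := rpow_nonneg (by linarith) _
    nlinarith
  have h00 : SS d 0 t ≤ 1 / (1-2*d) := by
    have h := SS_rec d h1 0 ht0 ht
    have h3 := hle 1
    have h4 := SS_nonneg d 0 ht0 ht.le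
    have h5 : t ^ (((0:ℕ):ℝ)+1-d) ≤ 1 := rpow_le_one ht0 ht.le (by push_cast; linarith)
    rw [le_div_iff₀ hd]
    have h6 : SS d 1 t ≤ SS d 0 t := by nlinarith
    push_cast at h h5
    simp only [zero_add] at h h5
    nlinarith
  exact (hle k).trans (by gcongr)

lemma SS_cont (d : ℝ) (h1 : d < 1/2) (k : ℕ) : ContinuousOn (SS d k) (Ico 0 1) := by
  intro t ht
  have ht2 : (t+1)/2 < 1 := by have := ht.2; linarith
  have ht3 : t < (t+1)/2 := by have := ht.2; linarith
  have hB := BB_cont d h1 k (t := (t+1)/2) (by have := ht.1; linarith) ht2 t ⟨ht.1, ht3.le⟩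
  have hB' : ContinuousWithinAt (BB d k) (Ico 0 1) t := by
    apply hB.mono_of_mem_nhdsWithin
    rw [mem_nhdsWithin]
    exact ⟨Iio ((t+1)/2), isOpen_Iio, ht3, fun x hx => ⟨hx.2.1, le_of_lt hx.1⟩⟩
  unfold SS
  apply ContinuousWithinAt.mul _ hB'
  apply ContinuousWithinAt.rpow_const (by fun_prop)
  left; have := ht.2; linarith

lemma SS_meas (d : ℝ) (h1 : d < 1/2) (k : ℕ) :
    AEStronglyMeasurable (SS d k) (volume.restrict (Ioc 0 1)) := by
  rw [← Measure.restrict_congr_set (Ioo_ae_eq_Ioc (μ := volume) (a := (0:ℝ)) (b := 1))]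
  exact ((SS_cont d h1 k).mono Ioo_subset_Ico_self).aestronglyMeasurable measurableSet_Ioo

lemma SS_bdd (d : ℝ) (h0 : 0 ≤ d) (h1 : d < 1/2) (k : ℕ) {t : ℝ} (ht0 : 0 ≤ t) (ht : t ≤ 1) :
    ‖SS d k t‖ ≤ 1 / (1-2*d) := by
  have hd : 0 < 1 - 2*d := by linarith
  rw [norm_of_nonneg (SS_nonneg d k ht0 ht)]
  refine (SS_le d h0 h1 k ht0 ht).trans ?_
  have := pow_le_one₀ (n := k) ht0 ht
  have : 0 < 1 / (1-2*d) := by positivity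
  nlinarith

lemma mm_int (d : ℝ) (h0 : 0 ≤ d) (h1 : d < 1/2) (k : ℕ) :
    IntervalIntegrable (fun t => t ^ (-d) * SS d k t) volume 0 1 := by
  have h : IntervalIntegrable (fun x : ℝ => x ^ (-d)) volume 0 1 := intervalIntegrable_rpow' (by linarith)
  rw [intervalIntegrable_iff_integrableOn_Ioc_of_le zero_le_one] at h ⊢
  refine Integrable.mul_bdd (c := 1 / (1-2*d)) h (SS_meas d h1 k) ?_
  filter_upwards [ae_restrict_mem measurableSet_Ioc] with t ht
  exact SS_bdd d h0 h1 k ht.1.le ht.2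

lemma SSsq_int (d : ℝ) (h0 : 0 ≤ d) (h1 : d < 1/2) :
    IntervalIntegrable (fun t => SS d 0 t ^ 2) volume 0 1 := by
  have h : IntervalIntegrable (fun x : ℝ => (1:ℝ)) volume 0 1 := by simp
  rw [intervalIntegrable_iff_integrableOn_Ioc_of_le zero_le_one] at h ⊢
  have hb : ∀ᵐ t ∂(volume.restrict (Ioc (0:ℝ) 1)), ‖SS d 0 t‖ ≤ 1 / (1-2*d) := by
    filter_upwards [ae_restrict_mem measurableSet_Ioc] with t ht
    exact SS_bdd d h0 h1 0 ht.1.le ht.2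
  have h2 := Integrable.mul_bdd (c := 1 / (1-2*d)) (Integrable.mul_bdd (c := 1 / (1-2*d)) h (SS_meas d h1 0) hb) (SS_meas d h1 0) hb
  refine h2.congr (Filter.Eventually.of_forall fun t => ?_)
  simp only; ring

lemma mm_rec (d : ℝ) (h0 : 0 ≤ d) (h1 : d < 1/2) (k : ℕ) :
    1 / ((k:ℝ)+2-2*d) = (k+1-d) * mm d k - (k+d) * mm d (k+1) := by
  have hk : (0:ℝ) ≤ k := Nat.cast_nonneg k
  unfold mm
  rw [← intervalIntegral.integral_const_mul, ← intervalIntegral.integral_const_mul,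
    ← intervalIntegral.integral_sub ((mm_int d h0 h1 k).const_mul _) ((mm_int d h0 h1 (k+1)).const_mul _)]
  have : ∫ t in (0:ℝ)..1, t ^ ((k:ℝ)+1-2*d) = 1 / ((k:ℝ)+2-2*d) := by
    rw [integral_rpow (Or.inl (by linarith)), one_rpow, zero_rpow (by linarith)]
    congr 1 <;> ring
  rw [← this]
  apply intervalIntegral.integral_congr_ae
  have : ∀ᵐ t ∂(volume : Measure ℝ), t ≠ 1 := Measure.ae_ne volume 1
  filter_upwards [this] with t ht1 ht
  rw [uIoc_of_le zero_le_one] at ht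
  have := SS_rec d h1 k ht.1.le (lt_of_le_of_ne ht.2 ht1)
  have e : t ^ ((k:ℝ)+1-2*d) = t ^ (-d) * t ^ ((k:ℝ)+1-d) := by
    rw [← rpow_add ht.1]; congr 1; ring
  rw [e, this]; ring

lemma mm_nonneg (d : ℝ) (k : ℕ) : 0 ≤ mm d k :=
  intervalIntegral.integral_nonneg zero_le_one
    (fun t ht => mul_nonneg (rpow_nonneg ht.1 _) (SS_nonneg d k ht.1 ht.2))

lemma mm_le (d : ℝ) (h0 : 0 ≤ d) (h1 : d < 1/2) (k : ℕ) :
    mm d k ≤ 1 / (1-2*d) * (1 / ((k:ℝ)+1-d)) := by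
  have hk : (0:ℝ) ≤ k := Nat.cast_nonneg k
  have : ∫ t in (0:ℝ)..1, t ^ ((k:ℝ)-d) = 1 / ((k:ℝ)+1-d) := by
    rw [integral_rpow (Or.inl (by linarith)), one_rpow, zero_rpow (by linarith)]
    congr 1 <;> ring
  rw [← this, ← intervalIntegral.integral_const_mul]
  apply intervalIntegral.integral_mono_on_of_le_Ioo zero_le_one (mm_int d h0 h1 k)
    ((intervalIntegrable_rpow' (by linarith)).const_mul _)
  intro t ht
  have e : t ^ ((k:ℝ)-d) = t ^ (-d) * t ^ k := by
    rw [← rpow_natCast, ← rpow_add ht.1]; congr 1; ring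
  rw [e]
  have := SS_le d h0 h1 k ht.1.le ht.2.le
  have h2 : 0 ≤ t ^ (-d) := rpow_nonneg ht.1.le _
  nlinarith

lemma poch_succ (a : ℝ) (k : ℕ) : poch a (k+1) = poch a k * (a + k) := by
  simp [poch, Finset.prod_range_succ]

lemma poch_pos {a : ℝ} (h : 0 < a) (k : ℕ) : 0 < poch a k :=
  Finset.prod_pos (fun i _ => by positivity)

lemma poch_nonneg {a : ℝ} (h : 0 ≤ a) (k : ℕ) : 0 ≤ poch a k :=
  Finset.prod_nonneg (fun i _ => by positivity)

lemma poch_one (k : ℕ) : poch 1 k = (Nat.factorial k : ℝ) := by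
  induction k with
  | zero => simp [poch]
  | succ n ih => rw [poch_succ, ih, Nat.factorial_succ]; push_cast; ring

lemma poch_shift (a : ℝ) (h : 0 < a) (k : ℕ) : poch a k * (a + k) = a * poch (a+1) k := by
  induction k with
  | zero => simp [poch]
  | succ n ih => rw [poch_succ, ih, poch_succ]; push_cast; ring

noncomputable def ff (d : ℝ) (k : ℕ) : ℝ := poch d k / poch (2-d) k

lemma ff_succ (d : ℝ) (h1 : d < 1/2) (k : ℕ) : ff d (k+1) * (k+2-d) = ff d k * (k + d) := by
  have := poch_pos (a := 2-d) (by linarith) k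
  have : (0:ℝ) < 2 - d + k := by have : (0:ℝ) ≤ k := Nat.cast_nonneg k; linarith
  unfold ff
  rw [poch_succ, poch_succ]
  field_simp
  ring

lemma ff_nonneg (d : ℝ) (h0 : 0 ≤ d) (h1 : d < 1/2) (k : ℕ) : 0 ≤ ff d k :=
  div_nonneg (poch_nonneg h0 k) (poch_nonneg (by linarith) k)

lemma uu_le (d : ℝ) (h0 : 0 ≤ d) (h1 : d < 1/2) (k : ℕ) : ff d k * (k+1-d) ≤ 1 := by
  induction k with
  | zero => simp [ff, poch]; linarith
  | succ n ih =>
    have := ff_succ d h1 n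
    have := ff_nonneg d h0 h1 n
    push_cast
    nlinarith

lemma partial_sum (d : ℝ) (h0 : 0 ≤ d) (h1 : d < 1/2) (n : ℕ) :
    ∑ k ∈ Finset.range n, ff d k * (1 / ((k:ℝ)+2-2*d)) = (1-d) * mm d 0 - ff d n * (n+1-d) * mm d n := by
  induction n with
  | zero => simp [ff, poch]
  | succ n ih =>
    rw [Finset.sum_range_succ, ih, mm_rec d h0 h1 n]
    have := ff_succ d h1 n
    push_cast
    linear_combination mm d (n+1) * this

lemma F32_eq (d : ℝ) (h0 : 0 ≤ d) (h1 : d < 1/2) :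
    F32 1 d (2-2*d) (2-d) (3-2*d) = (2-2*d) * ((1-d) * mm d 0) := by
  have hs : HasSum (fun k : ℕ => ff d k * (1 / ((k:ℝ)+2-2*d))) ((1-d) * mm d 0) := by
    rw [hasSum_iff_tendsto_nat_of_nonneg]
    · simp_rw [partial_sum d h0 h1]
      have hz : Filter.Tendsto (fun n : ℕ => ff d n * (n+1-d) * mm d n) Filter.atTop (nhds 0) := by
        have hl : Filter.Tendsto (fun n : ℕ => 1 / (1-2*d) * (1 / ((n:ℝ)+1-d))) Filter.atTop (nhds 0) := by
          have : Filter.Tendsto (fun n : ℕ => (n:ℝ)+(1-d)) Filter.atTop Filter.atTop :=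
            Filter.tendsto_atTop_add_const_right _ _ tendsto_natCast_atTop_atTop
          have := (this.inv_tendsto_atTop).const_mul (1 / (1-2*d))
          simp only [mul_zero] at this
          refine this.congr (fun n => ?_)
          simp only [Pi.inv_apply, one_div]
          congr 2; ring
        refine squeeze_zero (fun n => ?_) (fun n => ?_) hl
        · have := ff_nonneg d h0 h1 n
          have := mm_nonneg d n
          have : (0:ℝ) ≤ n + 1 - d := by have : (0:ℝ) ≤ n := Nat.cast_nonneg n; linarith
          positivity
        · refine le_trans ?_ (mm_le d h0 h1 n)
          have := uu_le d h0 h1 n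
          have := mm_nonneg d n
          nlinarith
      simpa using hz.const_sub ((1-d) * mm d 0)
    · intro k
      have := ff_nonneg d h0 h1 k
      have : (0:ℝ) ≤ k + 2 - 2*d := by have : (0:ℝ) ≤ k := Nat.cast_nonneg k; linarith
      positivity
  rw [← (hs.mul_left (2-2*d)).tsum_eq]
  unfold F32
  congr 1
  ext k
  have hp := poch_shift (2-2*d) (by linarith) k
  rw [show 2-2*d+1 = 3-2*d by ring] at hp
  have h3 := poch_pos (a := 3-2*d) (by linarith) k
  have h2 := poch_pos (a := 2-d) (by linarith) k
  have hf : (0:ℝ) < (Nat.factorial k : ℝ) := by positivity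
  have : (0:ℝ) < k + 2 - 2*d := by have : (0:ℝ) ≤ k := Nat.cast_nonneg k; linarith
  rw [poch_one, ff]
  generalize poch (2-2*d) k = X at *
  generalize poch (3-2*d) k = Y at *
  generalize poch (2-d) k = Z at *
  generalize poch d k = W at *
  field_simp
  linear_combination W * hp

lemma main_id (d : ℝ) (h0 : 0 ≤ d) (h1 : d < 1/2) :
    (3-4*d) * ∫ t in (0:ℝ)..1, SS d 0 t ^ 2 = 2 * mm d 0 := by
  have hd : 0 < 1 - 2*d := by linarith
  have key := integral_eq_sub_of_hasDerivAt_of_le (a := 0) (b := 1) zero_le_one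
    (f := fun t : ℝ => (1-t) * SS d 0 t ^ 2)
    (f' := fun t : ℝ => 2 * (t ^ (-d) * SS d 0 t) - (3-4*d) * SS d 0 t ^ 2)
    (by
      intro t ht
      rcases ht.2.eq_or_lt with rfl | ht1
      · have hlim : Filter.Tendsto (fun t : ℝ => (1-t) * (1/(1-2*d))^2) (nhdsWithin 1 (Icc 0 1)) (nhds 0) := by
          have : Continuous (fun t : ℝ => (1-t) * (1/(1-2*d))^2) := by fun_prop
          have := (this.tendsto 1).mono_left (nhdsWithin_le_nhds (s := Icc 0 1))
          simpa using this
        unfold ContinuousWithinAt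
        simp only [sub_self, zero_mul]
        refine squeeze_zero' ?_ ?_ hlim
        · filter_upwards [self_mem_nhdsWithin] with x hx
          have := hx.2
          exact mul_nonneg (by linarith) (sq_nonneg _)
        · filter_upwards [self_mem_nhdsWithin] with x hx
          have h2 := SS_bdd d h0 h1 0 hx.1 hx.2
          rw [norm_of_nonneg (SS_nonneg d 0 hx.1 hx.2)] at h2
          have h3 := SS_nonneg d 0 hx.1 hx.2
          have := hx.2
          exact mul_le_mul_of_nonneg_left (pow_le_pow_left₀ h3 h2 2) (by linarith)
      · have hc := SS_cont d h1 0 t ⟨ht.1, ht1⟩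
        have hc' : ContinuousWithinAt (SS d 0) (Icc 0 1) t := by
          apply hc.mono_of_mem_nhdsWithin
          rw [mem_nhdsWithin]
          exact ⟨Iio 1, isOpen_Iio, ht1, fun x hx => ⟨hx.2.1, hx.1⟩⟩
        exact ContinuousWithinAt.mul (by fun_prop) (hc'.pow 2))
    (by
      intro t ht
      have ht0 : 0 < t := ht.1
      have ht1 : 0 < 1 - t := by have := ht.2; linarith
      have e1 : HasDerivAt (fun x : ℝ => (1-x) ^ (1-2*d)) (-1 * (1-2*d) * (1-t)^(1-2*d-1)) t :=
        ((hasDerivAt_id t).const_sub 1).rpow_const (Or.inl ht1.ne')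
      have e2 := e1.mul (BB_deriv d h1 0 ht0 ht.2)
      have e3 := ((hasDerivAt_id t).const_sub 1).mul (e2.pow 2)
      refine HasDerivAt.congr_deriv (f' := _) (HasDerivAt.congr_of_eventuallyEq e3 (Filter.Eventually.of_forall fun x => ?_)) ?_
      · simp [SS]
      · have a1 : (1-t)^(1-2*d-1) * (1-t) = (1-t)^(1-2*d) := by
          rw [← rpow_add_one ht1.ne']; congr 1; ring
        have a2 : (1-t)^(1-2*d) * (1-t)^(2*d-2) * (1-t) = 1 := by
          rw [← rpow_add ht1, ← rpow_add_one ht1.ne', show 1-2*d+(2*d-2)+1 = (0:ℝ) by ring, rpow_zero]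
        simp only [SS, gg, id, Pi.mul_apply, Pi.pow_apply, pow_zero, one_mul]
        push_cast
        set P := (1-t)^(1-2*d)
        set Q := (1-t)^(1-2*d-1)
        set R := (1-t)^(2*d-2)
        set T := t ^ (-d)
        set B := BB d 0 t
        linear_combination (-2*(1-2*d)*P*B^2) * a1 + (2*P*B*T) * a2)
    (((mm_int d h0 h1 0).const_mul _).sub ((SSsq_int d h0 h1).const_mul _))
  rw [intervalIntegral.integral_sub ((mm_int d h0 h1 0).const_mul _) ((SSsq_int d h0 h1).const_mul _),
    intervalIntegral.integral_const_mul, intervalIntegral.integral_const_mul] at key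
  have hS0 : SS d 0 0 = 0 := by simp [SS, BB]
  simp only [sub_self, zero_mul, hS0] at key
  unfold mm
  have z : (1 - (0:ℝ)) * 0 ^ 2 = 0 := by norm_num
  rw [z] at key
  linarith

/-- integrand -/
lemma hh_int (d : ℝ) (h1 : d < 1/2) {a b : ℝ} (hb : 0 < b) (hab : b < a) :
    IntervalIntegrable (fun s => (a-s)^(-d) * (b-s)^(-d)) volume 0 b := by
  have h : IntervalIntegrable (fun x : ℝ => x ^ (-d)) volume 0 b := intervalIntegrable_rpow' (by linarith)
  have h2 := (h.comp_sub_left b).symm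
  simp only [sub_self, sub_zero] at h2
  refine h2.continuousOn_mul ?_
  rw [uIcc_of_le hb.le]
  exact ContinuousOn.rpow_const (by fun_prop) (fun x hx => Or.inl (by have := hx.2; linarith))

lemma hh_eval (d : ℝ) (h1 : d < 1/2) {a b : ℝ} (hb : 0 < b) (hab : b < a) :
    ∫ s in (0:ℝ)..b, (a-s)^(-d) * (b-s)^(-d) = a ^ (1-2*d) * SS d 0 (b/a) := by
  have ha : 0 < a := hb.trans hab
  have hba : b / a < 1 := (div_lt_one ha).2 hab
  have hm : ∀ s ∈ Icc 0 b, (b-s)/(a-s) ∈ Icc 0 (b/a) := by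
    intro s hs
    have h2 : 0 < a - s := by have := hs.2; linarith
    refine ⟨div_nonneg (by have := hs.2; linarith) h2.le, ?_⟩
    rw [div_le_div_iff₀ h2 ha]
    nlinarith [hs.1]
  have key := integral_eq_sub_of_hasDerivAt_of_le (a := 0) (b := b) hb.le
    (f := fun s : ℝ => BB d 0 ((b-s)/(a-s)))
    (f' := fun s : ℝ => (-(a-b)^(2*d-1)) * ((a-s)^(-d) * (b-s)^(-d)))
    (by
      refine (BB_cont d h1 0 (t := b/a) (by positivity) hba).comp ?_ hm
      refine ContinuousOn.div (by fun_prop) (by fun_prop) (fun x hx => ?_)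
      have := hx.2
      have : 0 < a - x := by linarith
      exact this.ne')
    (by
      intro s hs
      have h2 : 0 < a - s := by have := hs.2; linarith
      have h3 : 0 < b - s := by have := hs.2; linarith
      have h4 : 0 < a - b := by linarith
      have hv0 : 0 < (b-s)/(a-s) := by positivity
      have hv1 : (b-s)/(a-s) < 1 := by rw [div_lt_one h2]; linarith
      have e1 := ((hasDerivAt_id s).const_sub b).div ((hasDerivAt_id s).const_sub a) h2.ne'
      have e2 := (BB_deriv d h1 0 hv0 hv1).comp s e1
      refine e2.congr_deriv ?_
      have e : 1 - (b-s)/(a-s) = (a-b)/(a-s) := by field_simp; ring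
      simp only [gg, id, pow_zero, one_mul]
      rw [e, div_rpow h3.le h2.le, div_rpow h4.le h2.le]
      have a1 : (a-s)^(2*d-2) = ((a-s)^(-d))⁻¹ * ((a-s)^(-d))⁻¹ * ((a-s)^2)⁻¹ := by
        rw [← rpow_neg h2.le, ← rpow_natCast, ← rpow_neg h2.le, ← rpow_add h2, ← rpow_add h2]
        congr 1; push_cast; ring
      have a2 : (a-b)^(2*d-1) = (a-b)^(2*d-2) * (a-b) := by
        rw [← rpow_add_one h4.ne']; congr 1; ring
      have p1 : 0 < (a-s)^(-d) := rpow_pos_of_pos h2 _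
      rw [a1, a2]
      field_simp
      ring)
    ((hh_int d h1 hb hab).const_mul _)
  rw [intervalIntegral.integral_const_mul] at key
  simp only [sub_self, zero_div, sub_zero] at key
  have hB0 : BB d 0 0 = 0 := by simp [BB]
  rw [hB0] at key
  have h4 : 0 < a - b := by linarith
  have a3 : (a-b)^(1-2*d) * (a-b)^(2*d-1) = 1 := by
    rw [← rpow_add h4]; simp
  have a4 : a ^ (1-2*d) * (1 - b/a)^(1-2*d) = (a-b)^(1-2*d) := by
    rw [← mul_rpow ha.le (by linarith)]; congr 1; field_simp
  unfold SS
  rw [← mul_assoc, a4]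
  set I := ∫ s in (0:ℝ)..b, (a-s)^(-d) * (b-s)^(-d)
  linear_combination (-I) * a3 - (a-b)^(1-2*d) * key

lemma half_sq (d : ℝ) (h1 : d < 1/2) {a b : ℝ} (hb : 0 < b) (hab : b < a) :
    (∫ y3 in (0:ℝ)..b, ∫ y4 in (0:ℝ)..y3,
      (a - y3) ^ (-d) * (b - y3) ^ (-d) * (a - y4) ^ (-d) * (b - y4) ^ (-d)) =
    1/2 * (a ^ (1-2*d) * SS d 0 (b/a))^2 := by
  rw [← hh_eval d h1 hb hab]
  set g : ℝ → ℝ := fun s => (a-s)^(-d) * (b-s)^(-d) with hg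
  have hgi : IntervalIntegrable g volume 0 b := hh_int d h1 hb hab
  have hc : ContinuousOn (fun x => ∫ s in (0:ℝ)..x, g s) (Icc 0 b) := by
    have := continuousOn_primitive_interval (μ := volume) (f := g) (a := 0) (b := b)
      (by rw [← intervalIntegrable_iff']; exact hgi)
    rwa [uIcc_of_le hb.le] at this
  have hgc : ContinuousOn g (Iio b) := by
    apply ContinuousOn.mul
    · exact ContinuousOn.rpow_const (by fun_prop) (fun x hx => Or.inl (by have : x < b := hx; linarith))
    · exact ContinuousOn.rpow_const (by fun_prop) (fun x hx => Or.inl (by have : x < b := hx; linarith))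
  have key := integral_eq_sub_of_hasDerivAt_of_le (a := 0) (b := b) hb.le
    (f := fun x : ℝ => 1/2 * (∫ s in (0:ℝ)..x, g s)^2)
    (f' := fun x : ℝ => g x * ∫ s in (0:ℝ)..x, g s)
    (by exact (hc.pow 2).const_mul _)
    (by
      intro x hx
      have hx' : uIcc 0 x ⊆ uIcc 0 b := by
        rw [uIcc_of_le hb.le, uIcc_of_le hx.1.le]; exact Icc_subset_Icc le_rfl hx.2.le
      have e := integral_hasDerivAt_right (hgi.mono_set hx')
        (hgc.stronglyMeasurableAtFilter isOpen_Iio x hx.2)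
        (hgc.continuousAt (Iio_mem_nhds hx.2))
      refine ((e.pow 2).const_mul (1/2)).congr_deriv ?_
      push_cast; ring)
    (by
      refine hgi.mul_continuousOn ?_
      rwa [uIcc_of_le hb.le])
  simp only [intervalIntegral.integral_same] at key
  have : ∀ y3, (∫ y4 in (0:ℝ)..y3,
      (a - y3) ^ (-d) * (b - y3) ^ (-d) * (a - y4) ^ (-d) * (b - y4) ^ (-d)) = g y3 * ∫ s in (0:ℝ)..y3, g s := by
    intro y3
    rw [← intervalIntegral.integral_const_mul]
    congr 1; ext y4; simp only [hg]; ring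
  simp_rw [this]
  rw [key]; ring

lemma inner2 (d : ℝ) (h1 : d < 1/2) {a : ℝ} (ha : 0 < a) :
    (∫ y2 in (0:ℝ)..a, ∫ y3 in (0:ℝ)..y2, ∫ y4 in (0:ℝ)..y3,
      (a - y3) ^ (-d) * (y2 - y3) ^ (-d) * (a - y4) ^ (-d) * (y2 - y4) ^ (-d)) =
    a ^ (3-4*d) * (1/2 * ∫ t in (0:ℝ)..1, SS d 0 t ^ 2) := by
  have : (∫ y2 in (0:ℝ)..a, ∫ y3 in (0:ℝ)..y2, ∫ y4 in (0:ℝ)..y3,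
      (a - y3) ^ (-d) * (y2 - y3) ^ (-d) * (a - y4) ^ (-d) * (y2 - y4) ^ (-d)) =
      ∫ y2 in (0:ℝ)..a, 1/2 * (a ^ (1-2*d))^2 * (fun t => SS d 0 t ^ 2) (y2/a) := by
    apply intervalIntegral.integral_congr_ae
    have : ∀ᵐ t ∂(volume : Measure ℝ), t ≠ a := Measure.ae_ne volume a
    filter_upwards [this] with t ht1 ht
    rw [uIoc_of_le ha.le] at ht
    rw [half_sq d h1 ht.1 (lt_of_le_of_ne ht.2 ht1)]
    ring
  rw [this, intervalIntegral.integral_const_mul, intervalIntegral.integral_comp_div (fun t => SS d 0 t ^ 2) ha.ne']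
  have e : a ^ (3-4*d) = (a ^ (1-2*d))^2 * a := by
    rw [← rpow_natCast, ← rpow_mul ha.le, ← rpow_add_one ha.ne']; congr 1; push_cast; ring
  rw [e, zero_div, div_self ha.ne', smul_eq_mul]; ring

theorem stmt5 (d : ℝ) (h0 : 0 ≤ d) (h1 : d < 1/2) :
    (∫ y1 in (0:ℝ)..1, ∫ y2 in (0:ℝ)..y1, ∫ y3 in (0:ℝ)..y2, ∫ y4 in (0:ℝ)..y3,
      (y1 - y3) ^ (-d) * (y2 - y3) ^ (-d) * (y1 - y4) ^ (-d) * (y2 - y4) ^ (-d)) =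
    1 / (2 * (1-d) ^ 2) * (Gamma (3-4*d) / Gamma (5-4*d)) * F32 1 d (2-2*d) (2-d) (3-2*d) := by
  have e : (∫ y1 in (0:ℝ)..1, ∫ y2 in (0:ℝ)..y1, ∫ y3 in (0:ℝ)..y2, ∫ y4 in (0:ℝ)..y3,
      (y1 - y3) ^ (-d) * (y2 - y3) ^ (-d) * (y1 - y4) ^ (-d) * (y2 - y4) ^ (-d)) =
      ∫ y1 in (0:ℝ)..1, y1 ^ (3-4*d) * (1/2 * ∫ t in (0:ℝ)..1, SS d 0 t ^ 2) := by
    apply intervalIntegral.integral_congr_ae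
    refine Filter.Eventually.of_forall fun t ht => ?_
    rw [uIoc_of_le zero_le_one] at ht
    exact inner2 d h1 ht.1
  have hm := main_id d h0 h1
  rw [e, intervalIntegral.integral_mul_const, integral_rpow (Or.inl (by linarith)), one_rpow,
    zero_rpow (by linarith), F32_eq d h0 h1]
  have g1 : Gamma (5-4*d) = (4-4*d) * ((3-4*d) * Gamma (3-4*d)) := by
    rw [← Real.Gamma_add_one (by linarith), show 3-4*d+1 = 4-4*d by ring,
      ← Real.Gamma_add_one (by linarith)]
    congr 1; ring
  have hG : 0 < Gamma (3-4*d) := Gamma_pos_of_pos (by linarith)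
  have p3 : 0 < 3-4*d := by linarith
  have p4 : 0 < 1-d := by linarith
  have hI : ∫ t in (0:ℝ)..1, SS d 0 t ^ 2 = 2 * mm d 0 / (3-4*d) := by
    rw [eq_div_iff p3.ne']; linarith
  rw [g1, hI, show 4-4*d = 4*(1-d) by ring, show 2-2*d = 2*(1-d) by ring, show 3-4*d+1 = 4*(1-d) by ring]
  field_simp
  ring
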